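/- Let σ > 0, θ > 0, and let r : ℤ → ℝ satisfy r(0) = 1, r(−k) = r(k), Σ_k |r(k)| < ∞, with spectral density f_s(ω) = Σ_{k∈ℤ} r(k)e^{−ikω} satisfying 0 ≤ f_s(ω) ≤ M for all ω, and suppose each Toeplitz matrix Σ_{s,n} = (r(i−j))_{1≤i,j≤n} is positive semidefinite. For each n let y_n ~ N(0, σ²I + θ²Σ_{s,n}) and define T_{sq,n} = (1/2)·log(σ²/(σ²+θ²)) + (θ²/(2nσ²(σ²+θ²)))·Σ_{i=1}^n (y_n)_i². Then for every real t with t·θ²(σ²+θ²M)/(σ²(σ²+θ²)) < 1, lim_{n→∞} (1/n)·log E[exp(n·t·T_{sq,n})] = (t/2)·log(σ²/(σ²+θ²)) − (1/4π)∫₀^{2π} log(1 − t·θ²(σ²+θ²f_s(ω))/(σ²(σ²+θ²))) dω. -/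

import Mathlib

open MeasureTheory Matrix ProbabilityTheory Filter Topology

lemma Matrix.PosSemidef.exists_orthogonal_diagonalization {n : ℕ} {S : Matrix (Fin n) (Fin n) ℝ}
    (hS : S.PosSemidef) :
    ∃ (U : Matrix (Fin n) (Fin n) ℝ) (d : Fin n → ℝ),
      Uᵀ * U = 1 ∧ U * Uᵀ = 1 ∧ S = U * diagonal d * Uᵀ ∧ ∀ i, 0 ≤ d i := by
  refine ⟨hS.1.eigenvectorUnitary, hS.1.eigenvalues, ?_, ?_, ?_, hS.eigenvalues_nonneg⟩
  · simpa [star_eq_conjTranspose, conjTranspose_eq_transpose_of_trivial] using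
      Unitary.coe_star_mul_self hS.1.eigenvectorUnitary
  · simpa [star_eq_conjTranspose, conjTranspose_eq_transpose_of_trivial] using
      Unitary.coe_mul_star_self hS.1.eigenvectorUnitary
  · simpa [star_eq_conjTranspose, conjTranspose_eq_transpose_of_trivial,
      Unitary.conjStarAlgAut_apply, Function.comp_def] using hS.1.spectral_theorem

lemma sum_sq_mulVec_of_orthogonal {n : ℕ} {U : Matrix (Fin n) (Fin n) ℝ}
    (hU : Uᵀ * U = 1) (x : Fin n → ℝ) : ∑ i, (U *ᵥ x) i ^ 2 = ∑ i, x i ^ 2 := by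
  have h : ∀ y : Fin n → ℝ, ∑ i, y i ^ 2 = y ⬝ᵥ y := fun y => by
    simp [dotProduct, sq]
  rw [h, h, dotProduct_mulVec, vecMul_mulVec, hU, vecMul_one]

lemma map_mulVec_pi_gaussianReal_of_orthogonal {n : ℕ} {O : Matrix (Fin n) (Fin n) ℝ}
    (hO : Oᵀ * O = 1) :
    (Measure.pi fun _ : Fin n => gaussianReal 0 1).map O.mulVec
      = Measure.pi fun _ : Fin n => gaussianReal 0 1 := by
  let e : EuclideanSpace ℝ (Fin n) →ₗᵢ[ℝ] EuclideanSpace ℝ (Fin n) :=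
    { toLinearMap := toEuclideanLin O
      norm_map' := fun x => by
        rw [EuclideanSpace.norm_eq, EuclideanSpace.norm_eq]
        simpa using congrArg Real.sqrt (sum_sq_mulVec_of_orthogonal hO x.ofLp) }
  have h := stdGaussian_map (e.toLinearIsometryEquiv rfl)
  rw [← map_pi_eq_stdGaussian, Measure.map_map (by fun_prop) (by fun_prop)] at h
  have h2 := congrArg (Measure.map (WithLp.ofLp : EuclideanSpace ℝ (Fin n) → Fin n → ℝ)) h
  rw [Measure.map_map (by fun_prop) (by fun_prop),
    Measure.map_map (by fun_prop) (by fun_prop)] at h2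
  refine Eq.trans ?_ (h2.trans ?_)
  · rfl
  · exact Measure.map_id

lemma integral_exp_mul_sq_gaussianReal {a : ℝ} (ha : a < 1) :
    ∫ x, Real.exp (a / 2 * x ^ 2) ∂(gaussianReal 0 1) = 1 / √(1 - a) := by
  rw [integral_gaussianReal_eq_integral_smul one_ne_zero]
  have h : ∀ x : ℝ, gaussianPDFReal 0 1 x • Real.exp (a / 2 * x ^ 2)
      = (√(2 * Real.pi))⁻¹ * Real.exp (-((1 - a) / 2) * x ^ 2) := fun x => by
    rw [gaussianPDFReal, smul_eq_mul, mul_assoc, ← Real.exp_add]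
    simp only [NNReal.coe_one, mul_one, sub_zero]
    ring_nf
  simp_rw [h]
  rw [integral_const_mul, integral_gaussian, ← Real.sqrt_inv, ← Real.sqrt_mul (by positivity),
    one_div, ← Real.sqrt_inv]
  congr 1
  have : 1 - a ≠ 0 := by linarith
  field_simp

lemma integral_exp_sum_sq_map_mulVec {n : ℕ} {A U : Matrix (Fin n) (Fin n) ℝ} {e : Fin n → ℝ}
    (hU : Uᵀ * U = 1) (hU' : U * Uᵀ = 1) (hA : A * Aᵀ = U * diagonal e * Uᵀ)
    (he : ∀ i, 0 < e i) {s : ℝ} (hs : ∀ i, s * e i < 1) :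
    ∫ y, Real.exp (s / 2 * ∑ i, y i ^ 2)
        ∂(Measure.map A.mulVec (Measure.pi fun _ : Fin n => gaussianReal 0 1))
      = ∏ i, 1 / √(1 - s * e i) := by
  set D : Matrix (Fin n) (Fin n) ℝ := diagonal fun i => √(e i)
  set D' : Matrix (Fin n) (Fin n) ℝ := diagonal fun i => (√(e i))⁻¹
  have hs0 : ∀ i, √(e i) ≠ 0 := fun i => (Real.sqrt_pos.2 (he i)).ne'
  have hDD' : D * D' = 1 := by simp [D, D', hs0]
  have hD'eD' : D' * diagonal e * D' = 1 := by
    simp only [D', diagonal_mul_diagonal, ← diagonal_one]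
    congr 1; ext i
    have := Real.mul_self_sqrt (he i).le
    have := hs0 i
    field_simp
    nlinarith
  set O := D' * Uᵀ * A
  have hOO : O * Oᵀ = 1 := by
    have : Oᵀ = Aᵀ * (U * D') := by simp [O, D', transpose_mul, Matrix.mul_assoc]
    rw [this]
    calc D' * Uᵀ * A * (Aᵀ * (U * D')) = D' * Uᵀ * (A * Aᵀ) * (U * D') := by
          simp only [Matrix.mul_assoc]
      _ = D' * ((Uᵀ * U) * diagonal e * (Uᵀ * U)) * D' := by
          rw [hA]; simp only [Matrix.mul_assoc]
      _ = 1 := by rw [hU]; simpa using hD'eD'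
  have hO : Oᵀ * O = 1 := mul_eq_one_comm.1 hOO
  have hAO : A = U * (D * O) := by
    calc A = U * ((D * D') * (Uᵀ * A)) := by
          rw [hDD', Matrix.one_mul, ← Matrix.mul_assoc, hU', Matrix.one_mul]
      _ = _ := by simp only [O, Matrix.mul_assoc]
  have hcomp : A.mulVec = (U * D).mulVec ∘ O.mulVec := by
    ext x; simp [hAO, Matrix.mul_assoc]
  rw [hcomp, ← Measure.map_map (by fun_prop) (by fun_prop),
    map_mulVec_pi_gaussianReal_of_orthogonal hO,
    integral_map (by fun_prop) (Continuous.aestronglyMeasurable (by fun_prop))]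
  have h : ∀ x : Fin n → ℝ, Real.exp (s / 2 * ∑ i, ((U * D) *ᵥ x) i ^ 2)
      = ∏ i, Real.exp (s * e i / 2 * x i ^ 2) := fun x => by
    rw [← Real.exp_sum, ← mulVec_mulVec, sum_sq_mulVec_of_orthogonal hU, Finset.mul_sum]
    congr 1
    refine Finset.sum_congr rfl fun i _ => ?_
    rw [mulVec_diagonal, mul_pow, Real.sq_sqrt (he i).le]
    ring
  simp_rw [h]
  rw [integral_fintype_prod_eq_prod (fun i x => Real.exp (s * e i / 2 * x ^ 2))]
  exact Finset.prod_congr rfl fun i _ => integral_exp_mul_sq_gaussianReal (hs i)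

/-- The samples `cos (i ω + φ)`, `0 ≤ i < n`, of a sinusoid with frequency `ω` and phase `φ`. -/
noncomputable def sinusoid (n : ℕ) (φ ω : ℝ) : Fin n → ℝ := fun i => Real.cos ((i : ℕ) * ω + φ)

/-- The squared modulus of the trigonometric polynomial `∑ i, u i e^{iω}`, in real form. -/
noncomputable def powerSpectrum {n : ℕ} (u : Fin n → ℝ) (ω : ℝ) : ℝ :=
  (u ⬝ᵥ sinusoid n 0 ω) ^ 2 + (u ⬝ᵥ sinusoid n (Real.pi / 2) ω) ^ 2

lemma powerSpectrum_nonneg {n : ℕ} (u : Fin n → ℝ) (ω : ℝ) : 0 ≤ powerSpectrum u ω := by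
  unfold powerSpectrum; positivity

@[fun_prop]
lemma continuous_powerSpectrum {n : ℕ} (u : Fin n → ℝ) : Continuous (powerSpectrum u) := by
  unfold powerSpectrum dotProduct sinusoid; fun_prop

lemma powerSpectrum_eq_sum {n : ℕ} (u : Fin n → ℝ) (ω : ℝ) :
    powerSpectrum u ω
      = ∑ i, ∑ j, u i * u j * Real.cos (((i : ℕ) - (j : ℕ) : ℤ) * ω) := by
  simp only [powerSpectrum, dotProduct, sinusoid, sq, Finset.sum_mul_sum, add_zero,
    Real.cos_add_pi_div_two, ← Finset.sum_add_distrib]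
  refine Finset.sum_congr rfl fun i _ => Finset.sum_congr rfl fun j _ => ?_
  push_cast
  rw [sub_mul, Real.cos_sub]
  ring

lemma sum_sq_sinusoid_add {n : ℕ} (ω : ℝ) :
    ∑ i, sinusoid n 0 ω i ^ 2 + ∑ i, sinusoid n (Real.pi / 2) ω i ^ 2 = n := by
  simp [sinusoid, ← Finset.sum_add_distrib, Real.cos_add_pi_div_two]

lemma integral_cos_int_mul (k : ℤ) :
    ∫ ω in (0 : ℝ)..(2 * Real.pi), Real.cos (k * ω) = if k = 0 then 2 * Real.pi else 0 := by
  split_ifs with h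
  · simp [h]
  · have hk : (k : ℝ) ≠ 0 := by exact_mod_cast h
    rw [intervalIntegral.integral_comp_mul_left _ hk, integral_cos]
    have : Real.sin (k * (2 * Real.pi)) = 0 := by
      simpa using Real.sin_add_int_mul_two_pi 0 k
    simp [this]

lemma integral_cos_mul_cos_int (k m : ℤ) :
    ∫ ω in (0 : ℝ)..(2 * Real.pi), Real.cos (k * ω) * Real.cos (m * ω)
      = (if k = m then Real.pi else 0) + (if k = -m then Real.pi else 0) := by
  have h : ∀ ω : ℝ, Real.cos (k * ω) * Real.cos (m * ω)
      = (1 / 2) * (Real.cos ((k - m : ℤ) * ω) + Real.cos ((k + m : ℤ) * ω)) := fun ω => by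
    push_cast
    rw [sub_mul, add_mul, Real.cos_sub, Real.cos_add]
    ring
  simp_rw [h]
  rw [intervalIntegral.integral_const_mul, intervalIntegral.integral_add
    (Continuous.intervalIntegrable (by fun_prop) _ _)
    (Continuous.intervalIntegrable (by fun_prop) _ _),
    integral_cos_int_mul, integral_cos_int_mul]
  simp only [sub_eq_zero, add_eq_zero_iff_eq_neg]
  split_ifs <;> ring

section Toeplitz

variable {r : ℤ → ℝ} {f : ℝ → ℝ}

lemma integral_mul_cos_int (hsymm : ∀ k, r (-k) = r k) (hsum : Summable fun k => |r k|)
    (hf : ∀ ω φ : ℝ, HasSum (fun k : ℤ => r k * Real.cos (k * ω + φ)) (f ω * Real.cos φ))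
    (m : ℤ) :
    ∫ ω in (0 : ℝ)..(2 * Real.pi), f ω * Real.cos (m * ω) = 2 * Real.pi * r m := by
  have h1 : HasSum (fun k : ℤ => ∫ ω in (0 : ℝ)..(2 * Real.pi),
      r k * (Real.cos (k * ω) * Real.cos (m * ω)))
      (∫ ω in (0 : ℝ)..(2 * Real.pi), f ω * Real.cos (m * ω)) := by
    refine intervalIntegral.hasSum_integral_of_dominated_convergence (fun k _ => |r k|)
      (fun k => Continuous.aestronglyMeasurable (by fun_prop)) (fun k => ?_)
      (.of_forall fun _ _ => hsum) (by simp) (.of_forall fun ω _ => ?_)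
    · refine .of_forall fun ω _ => ?_
      rw [Real.norm_eq_abs, abs_mul, abs_mul]
      have h1 := Real.abs_cos_le_one (k * ω)
      have h2 := Real.abs_cos_le_one (m * ω)
      exact mul_le_of_le_one_right (abs_nonneg _) (mul_le_one₀ h1 (abs_nonneg _) h2)
    · have h0 := (hf ω 0).mul_right (Real.cos (m * ω))
      simpa [mul_assoc] using h0
  simp_rw [intervalIntegral.integral_const_mul, integral_cos_mul_cos_int, mul_add] at h1
  have h2 := (hasSum_ite_eq m (r m * Real.pi)).add (hasSum_ite_eq (-m) (r (-m) * Real.pi))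
  rw [h1.unique (h2.congr_fun ?_), hsymm]
  · ring
  · intro k
    simp only [mul_ite, mul_zero]
    congr 1 <;> split_ifs with h <;> simp [h]

lemma continuous_of_hasSum_cos (hsum : Summable fun k => |r k|)
    (hf : ∀ ω φ : ℝ, HasSum (fun k : ℤ => r k * Real.cos (k * ω + φ)) (f ω * Real.cos φ)) :
    Continuous f := by
  have h : f = fun ω => ∑' k : ℤ, r k * Real.cos (k * ω) := by
    ext ω
    simpa using (hf ω 0).tsum_eq.symm
  rw [h]
  refine continuous_tsum (fun k => by fun_prop) hsum fun k ω => ?_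
  rw [Real.norm_eq_abs, abs_mul]
  exact mul_le_of_le_one_right (abs_nonneg _) (Real.abs_cos_le_one _)

lemma integral_mul_powerSpectrum (hsymm : ∀ k, r (-k) = r k) (hsum : Summable fun k => |r k|)
    (hf : ∀ ω φ : ℝ, HasSum (fun k : ℤ => r k * Real.cos (k * ω + φ)) (f ω * Real.cos φ))
    {n : ℕ} (u : Fin n → ℝ) :
    ∫ ω in (0 : ℝ)..(2 * Real.pi), f ω * powerSpectrum u ω
      = 2 * Real.pi * (u ⬝ᵥ (of fun i j : Fin n => r ((i : ℕ) - (j : ℕ) : ℤ)) *ᵥ u) := by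
  have hc := continuous_of_hasSum_cos hsum hf
  have h : ∀ ω, f ω * powerSpectrum u ω
      = ∑ i, ∑ j, u i * u j * (f ω * Real.cos (((i : ℕ) - (j : ℕ) : ℤ) * ω)) := fun ω => by
    simp only [powerSpectrum_eq_sum, Finset.mul_sum]
    refine Finset.sum_congr rfl fun i _ => Finset.sum_congr rfl fun j _ => ?_
    ring
  simp_rw [h]
  rw [intervalIntegral.integral_finsetSum
    fun i _ => Continuous.intervalIntegrable (by fun_prop) _ _]
  simp only [dotProduct, mulVec, Finset.mul_sum, of_apply]
  refine Finset.sum_congr rfl fun i _ => ?_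
  rw [intervalIntegral.integral_finsetSum
    fun i _ => Continuous.intervalIntegrable (by fun_prop) _ _]
  refine Finset.sum_congr rfl fun j _ => ?_
  rw [intervalIntegral.integral_const_mul, integral_mul_cos_int hsymm hsum hf]
  ring

lemma integral_powerSpectrum {n : ℕ} (u : Fin n → ℝ) :
    ∫ ω in (0 : ℝ)..(2 * Real.pi), powerSpectrum u ω = 2 * Real.pi * (u ⬝ᵥ u) := by
  have h := integral_mul_powerSpectrum (r := fun k => if k = 0 then 1 else 0) (f := fun _ => 1)
    (by simp) (summable_of_ne_finset_zero (s := {0}) (by simp)) (fun ω φ => by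
      rw [one_mul]
      refine (hasSum_ite_eq (0 : ℤ) (Real.cos φ)).congr_fun fun k => ?_
      split_ifs with h <;> simp [h]) u
  have h1 : (of fun i j : Fin n => if ((i : ℕ) - (j : ℕ) : ℤ) = 0 then (1 : ℝ) else 0) = 1 := by
    ext i j
    simp [one_apply, sub_eq_zero, Fin.ext_iff]
  simpa [h1] using h

/-- The mass of the absolutely summable sequence `r` outside the open interval `(-m, m)`. -/
noncomputable def tailMass (r : ℤ → ℝ) (m : ℕ) : ℝ :=
  ∑' k : ℤ, if (m : ℤ) ≤ |k| then |r k| else 0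

lemma summable_ite_tail (hsum : Summable fun k => |r k|) (m : ℕ) :
    Summable fun k : ℤ => if (m : ℤ) ≤ |k| then |r k| else 0 :=
  hsum.of_nonneg_of_le (fun k => by split_ifs <;> simp) (fun k => by split_ifs <;> simp)

lemma tendsto_tailMass (hsum : Summable fun k => |r k|) :
    Tendsto (tailMass r) atTop (𝓝 0) := by
  have h := tendsto_tsum_of_dominated_convergence (𝓕 := atTop)
    (f := fun (m : ℕ) (k : ℤ) => if (m : ℤ) ≤ |k| then |r k| else 0) (g := fun _ => (0 : ℝ))
    (bound := fun k => |r k|) hsum (fun k => ?_) (.of_forall fun m k => ?_)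
  · rw [tsum_zero] at h
    exact h
  · refine tendsto_const_nhds.congr' ?_
    filter_upwards [eventually_gt_atTop k.natAbs] with m hm
    rw [if_neg (by rw [Int.abs_eq_natAbs]; omega)]
  · split_ifs <;> simp

lemma hasSum_tailMass_sub (hsum : Summable fun k => |r k|) (m : ℕ) (i : ℤ) :
    HasSum (fun j : ℤ => if (m : ℤ) ≤ |j - i| then |r (j - i)| else 0) (tailMass r m) :=
  ((Equiv.subRight i).hasSum_iff
    (f := fun k : ℤ => if (m : ℤ) ≤ |k| then |r k| else 0)).2 (summable_ite_tail hsum m).hasSum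

lemma hasSum_mul_cos_sub
    (hf : ∀ ω φ : ℝ, HasSum (fun k : ℤ => r k * Real.cos (k * ω + φ)) (f ω * Real.cos φ))
    (φ ω : ℝ) (i : ℤ) :
    HasSum (fun j : ℤ => r (j - i) * Real.cos (j * ω + φ)) (f ω * Real.cos (i * ω + φ)) := by
  refine ((Equiv.subRight i).hasSum_iff.2 (hf ω (i * ω + φ))).congr_fun fun j => ?_
  simp only [Function.comp, Equiv.subRight_apply]
  push_cast
  ring_nf

lemma hasSum_ite_toeplitz_mulVec_sinusoid (hsymm : ∀ k, r (-k) = r k) {n : ℕ} (φ ω : ℝ)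
    (i : Fin n) :
    HasSum (fun j : ℤ =>
        if 0 ≤ j ∧ j < n then r (j - (i : ℕ)) * Real.cos (j * ω + φ) else 0)
      (((of fun i j : Fin n => r ((i : ℕ) - (j : ℕ) : ℤ)) *ᵥ sinusoid n φ ω) i) := by
  have hinj : Function.Injective fun j : Fin n => ((j : ℕ) : ℤ) := fun x y h => by
    simpa [Fin.ext_iff] using h
  refine (hinj.hasSum_iff fun j hj => if_neg fun h => hj ?_).1 ?_
  · exact ⟨⟨j.toNat, by omega⟩, by simp; omega⟩
  · simp only [mulVec, dotProduct, of_apply, sinusoid]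
    refine (hasSum_fintype _).congr_fun fun j => ?_
    rw [Function.comp, if_pos (by omega), ← hsymm, neg_sub, Int.cast_natCast]

lemma abs_toeplitz_mulVec_sinusoid_sub_le (hsymm : ∀ k, r (-k) = r k)
    (hsum : Summable fun k => |r k|)
    (hf : ∀ ω φ : ℝ, HasSum (fun k : ℤ => r k * Real.cos (k * ω + φ)) (f ω * Real.cos φ))
    {n : ℕ} (φ ω : ℝ) (i : Fin n) :
    |((of fun i j : Fin n => r ((i : ℕ) - (j : ℕ) : ℤ)) *ᵥ sinusoid n φ ω) i
        - f ω * sinusoid n φ ω i| ≤ tailMass r (i + 1) + tailMass r (n - i) := by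
  have hd := (hasSum_ite_toeplitz_mulVec_sinusoid hsymm φ ω i).sub
    (hasSum_mul_cos_sub hf φ ω ((i : ℕ) : ℤ))
  have hb := (hasSum_tailMass_sub hsum (i + 1) ((i : ℕ) : ℤ)).add
    (hasSum_tailMass_sub hsum (n - i) ((i : ℕ) : ℤ))
  rw [Int.cast_natCast] at hd
  change |_ - f ω * Real.cos _| ≤ _
  rw [← hd.tsum_eq, ← Real.norm_eq_abs]
  refine tsum_of_norm_bounded hb fun j => ?_
  have hi := i.2
  have hnn : ∀ m : ℤ, 0 ≤ if m ≤ |j - (i : ℕ)| then |r (j - (i : ℕ))| else 0 := fun m => by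
    split_ifs <;> simp
  by_cases hj : 0 ≤ j ∧ j < n
  · rw [if_pos hj, sub_self, norm_zero]
    exact add_nonneg (hnn _) (hnn _)
  · rw [if_neg hj, zero_sub, norm_neg, Real.norm_eq_abs, abs_mul]
    refine (mul_le_of_le_one_right (abs_nonneg _) (Real.abs_cos_le_one _)).trans ?_
    rcases lt_or_ge j 0 with h | h
    · rw [if_pos (by rw [Int.abs_eq_natAbs]; omega)]
      exact le_add_of_nonneg_right (hnn _)
    · rw [if_pos (c := ((n - i : ℕ) : ℤ) ≤ _) (by rw [Int.abs_eq_natAbs]; omega)]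
      exact le_add_of_nonneg_left (hnn _)

lemma sum_sq_toeplitz_mulVec_sinusoid_sub_le (hsymm : ∀ k, r (-k) = r k)
    (hsum : Summable fun k => |r k|)
    (hf : ∀ ω φ : ℝ, HasSum (fun k : ℤ => r k * Real.cos (k * ω + φ)) (f ω * Real.cos φ))
    {n : ℕ} (φ ω : ℝ) :
    ∑ i, (((of fun i j : Fin n => r ((i : ℕ) - (j : ℕ) : ℤ)) *ᵥ sinusoid n φ ω) i
        - f ω * sinusoid n φ ω i) ^ 2 ≤ 4 * ∑ m ∈ Finset.range n, tailMass r (m + 1) ^ 2 := by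
  have h1 : ∑ i : Fin n, tailMass r (i + 1) ^ 2
      = ∑ m ∈ Finset.range n, tailMass r (m + 1) ^ 2 :=
    Fin.sum_univ_eq_sum_range (fun m => tailMass r (m + 1) ^ 2) n
  have h2 : ∑ i : Fin n, tailMass r (n - i) ^ 2
      = ∑ m ∈ Finset.range n, tailMass r (m + 1) ^ 2 := by
    rw [Fin.sum_univ_eq_sum_range (fun m => tailMass r (n - m) ^ 2) n,
      ← Finset.sum_range_reflect]
    refine Finset.sum_congr rfl fun m hm => ?_
    have := Finset.mem_range.1 hm
    congr 2
    omega
  calc _ ≤ ∑ i : Fin n, (2 * tailMass r (i + 1) ^ 2 + 2 * tailMass r (n - i) ^ 2) := by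
        refine Finset.sum_le_sum fun i _ => ?_
        have h := abs_toeplitz_mulVec_sinusoid_sub_le hsymm hsum hf φ ω i
        have h' := pow_le_pow_left₀ (abs_nonneg _) h 2
        rw [sq_abs] at h'
        nlinarith [sq_nonneg (tailMass r (i + 1) - tailMass r (n - i))]
    _ = _ := by
        rw [Finset.sum_add_distrib, ← Finset.mul_sum, ← Finset.mul_sum, h1, h2]
        ring

lemma eigenvalue_toeplitz_le (hsymm : ∀ k, r (-k) = r k) (hsum : Summable fun k => |r k|)
    (hf : ∀ ω φ : ℝ, HasSum (fun k : ℤ => r k * Real.cos (k * ω + φ)) (f ω * Real.cos φ))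
    {M : ℝ} (hM : ∀ ω, f ω ≤ M) {n : ℕ} {U : Matrix (Fin n) (Fin n) ℝ} {d : Fin n → ℝ}
    (hU : Uᵀ * U = 1)
    (hS : (of fun i j : Fin n => r ((i : ℕ) - (j : ℕ) : ℤ)) = U * diagonal d * Uᵀ) (i : Fin n) :
    d i ≤ M := by
  have hc := continuous_of_hasSum_cos hsum hf
  have hu : Uᵀ i ⬝ᵥ Uᵀ i = 1 := by
    have h := congrFun (congrFun hU i) i
    rwa [one_apply_eq, mul_apply'] at h
  have hd : Uᵀ i ⬝ᵥ (U * diagonal d * Uᵀ) *ᵥ Uᵀ i = d i := by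
    have h : Uᵀ * (U * diagonal d * Uᵀ * U) = diagonal d := by
      calc _ = (Uᵀ * U) * diagonal d * (Uᵀ * U) := by simp only [Matrix.mul_assoc]
        _ = _ := by rw [hU]; simp
    have h := congrFun (congrFun h i) i
    rwa [diagonal_apply_eq, mul_apply'] at h
  have h1 := integral_mul_powerSpectrum hsymm hsum hf (Uᵀ i)
  rw [hS, hd] at h1
  have h2 : ∫ ω in (0 : ℝ)..(2 * Real.pi), f ω * powerSpectrum (Uᵀ i) ω
      ≤ ∫ ω in (0 : ℝ)..(2 * Real.pi), M * powerSpectrum (Uᵀ i) ω :=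
    intervalIntegral.integral_mono (by positivity)
      (Continuous.intervalIntegrable (by fun_prop) _ _)
      (Continuous.intervalIntegrable (by fun_prop) _ _)
      fun ω => mul_le_mul_of_nonneg_right (hM ω) (powerSpectrum_nonneg _ _)
  rw [intervalIntegral.integral_const_mul, integral_powerSpectrum, hu, h1] at h2
  nlinarith [Real.pi_pos]

lemma sum_powerSpectrum_of_orthogonal {n : ℕ} {U : Matrix (Fin n) (Fin n) ℝ}
    (hU : U * Uᵀ = 1) (ω : ℝ) : ∑ i, powerSpectrum (Uᵀ i) ω = n := by
  have h (φ : ℝ) : ∑ i, (Uᵀ i ⬝ᵥ sinusoid n φ ω) ^ 2 = ∑ i, sinusoid n φ ω i ^ 2 :=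
    sum_sq_mulVec_of_orthogonal (U := Uᵀ) hU _
  simp only [powerSpectrum, Finset.sum_add_distrib, h, sum_sq_sinusoid_add]

lemma sum_sq_sub_mul_powerSpectrum_le (hsymm : ∀ k, r (-k) = r k)
    (hsum : Summable fun k => |r k|)
    (hf : ∀ ω φ : ℝ, HasSum (fun k : ℤ => r k * Real.cos (k * ω + φ)) (f ω * Real.cos φ))
    {n : ℕ} {U : Matrix (Fin n) (Fin n) ℝ} {d : Fin n → ℝ}
    (hU : Uᵀ * U = 1) (hU' : U * Uᵀ = 1)
    (hS : (of fun i j : Fin n => r ((i : ℕ) - (j : ℕ) : ℤ)) = U * diagonal d * Uᵀ) (ω : ℝ) :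
    ∑ i, (d i - f ω) ^ 2 * powerSpectrum (Uᵀ i) ω
      ≤ 8 * ∑ m ∈ Finset.range n, tailMass r (m + 1) ^ 2 := by
  have h (φ : ℝ) : ∑ i, ((d i - f ω) * (Uᵀ i ⬝ᵥ sinusoid n φ ω)) ^ 2
      ≤ 4 * ∑ m ∈ Finset.range n, tailMass r (m + 1) ^ 2 := by
    refine le_trans (le_of_eq ?_) (sum_sq_toeplitz_mulVec_sinusoid_sub_le hsymm hsum hf φ ω)
    rw [hS]
    set v := sinusoid n φ ω
    have h1 := sum_sq_mulVec_of_orthogonal (U := Uᵀ) hU' ((U * diagonal d * Uᵀ) *ᵥ v - f ω • v)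
    simp only [Pi.sub_apply, Pi.smul_apply, smul_eq_mul] at h1
    rw [← h1]
    refine Finset.sum_congr rfl fun i _ => ?_
    rw [mulVec_sub, mulVec_smul, mulVec_mulVec, ← Matrix.mul_assoc, ← Matrix.mul_assoc, hU,
      Matrix.one_mul, ← mulVec_mulVec, Pi.sub_apply, mulVec_diagonal, Pi.smul_apply, smul_eq_mul,
      sub_mul]
    rfl
  have h0 := add_le_add (h 0) (h (Real.pi / 2))
  rw [← Finset.sum_add_distrib] at h0
  calc _ = _ := Finset.sum_congr rfl fun i _ => by rw [powerSpectrum]; ring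
    _ ≤ _ := h0
    _ = _ := by ring

lemma abs_average_eigenvalues_sub_integral_le (hsymm : ∀ k, r (-k) = r k)
    (hsum : Summable fun k => |r k|)
    (hf : ∀ ω φ : ℝ, HasSum (fun k : ℤ => r k * Real.cos (k * ω + φ)) (f ω * Real.cos φ))
    {K : Set ℝ} (hfK : ∀ ω, f ω ∈ K) {g : ℝ → ℝ} {L : NNReal} (hg : LipschitzOnWith L g K)
    {n : ℕ} (hn : 0 < n) {U : Matrix (Fin n) (Fin n) ℝ} {d : Fin n → ℝ}
    (hU : Uᵀ * U = 1) (hU' : U * Uᵀ = 1)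
    (hS : (of fun i j : Fin n => r ((i : ℕ) - (j : ℕ) : ℤ)) = U * diagonal d * Uᵀ)
    (hd : ∀ i, d i ∈ K) :
    |(1 / (n : ℝ)) * ∑ i, g (d i)
        - (1 / (2 * Real.pi)) * ∫ ω in (0 : ℝ)..(2 * Real.pi), g (f ω)|
      ≤ L * √(8 * ((n : ℝ)⁻¹ * ∑ m ∈ Finset.range n, tailMass r (m + 1) ^ 2)) := by
  have hn' : (0 : ℝ) < n := by exact_mod_cast hn
  set ε := 8 * ((n : ℝ)⁻¹ * ∑ m ∈ Finset.range n, tailMass r (m + 1) ^ 2) with hε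
  have hgc : Continuous fun ω => g (f ω) :=
    hg.continuousOn.comp_continuous (continuous_of_hasSum_cos hsum hf) hfK
  have hone (i) : Uᵀ i ⬝ᵥ Uᵀ i = 1 := by
    have h := congrFun (congrFun hU i) i
    rwa [one_apply_eq, mul_apply'] at h
  have hint : (1 / (n : ℝ)) * ∑ i, g (d i)
        - (1 / (2 * Real.pi)) * ∫ ω in (0 : ℝ)..(2 * Real.pi), g (f ω)
      = (1 / (2 * Real.pi)) * ∫ ω in (0 : ℝ)..(2 * Real.pi),
          ((1 / (n : ℝ)) * ∑ i, g (d i) * powerSpectrum (Uᵀ i) ω - g (f ω)) := by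
    rw [intervalIntegral.integral_sub (Continuous.intervalIntegrable (by fun_prop) _ _)
      (hgc.intervalIntegrable _ _), intervalIntegral.integral_const_mul,
      intervalIntegral.integral_finsetSum
        fun i _ => Continuous.intervalIntegrable (by fun_prop) _ _]
    simp_rw [intervalIntegral.integral_const_mul, integral_powerSpectrum, hone]
    rw [← Finset.sum_mul]
    field_simp
  have hpt (ω : ℝ) :
      ‖(1 / (n : ℝ)) * ∑ i, g (d i) * powerSpectrum (Uᵀ i) ω - g (f ω)‖ ≤ L * √ε := by
    set w : Fin n → ℝ := fun i => (1 / (n : ℝ)) * powerSpectrum (Uᵀ i) ω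
    have hw0 (i) : 0 ≤ w i := mul_nonneg (by positivity) (powerSpectrum_nonneg _ _)
    have hw1 : ∑ i, w i = 1 := by
      rw [← Finset.mul_sum, sum_powerSpectrum_of_orthogonal hU']
      field_simp
    have hvar : ∑ i, w i * (d i - f ω) ^ 2 ≤ ε := by
      have h := mul_le_mul_of_nonneg_left
        (sum_sq_sub_mul_powerSpectrum_le hsymm hsum hf hU hU' hS ω) (inv_nonneg.2 hn'.le)
      calc _ = _ := ?_
        _ ≤ _ := h
        _ = ε := by rw [hε]; ring
      rw [Finset.mul_sum]
      exact Finset.sum_congr rfl fun i _ => by simp only [w]; ring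
    have hmean : ∑ i, w i * |d i - f ω| ≤ √ε := by
      refine Real.le_sqrt_of_sq_le (le_trans ?_ hvar)
      have h := Finset.sum_sq_le_sum_mul_sum_of_sq_le_mul Finset.univ
        (r := fun i => w i * |d i - f ω|) (f := w) (g := fun i => w i * (d i - f ω) ^ 2)
        (fun i _ => hw0 i) (fun i _ => mul_nonneg (hw0 i) (sq_nonneg _))
        (fun i _ => le_of_eq (by rw [mul_pow, sq_abs]; ring))
      rwa [hw1, one_mul] at h
    have heq : (1 / (n : ℝ)) * ∑ i, g (d i) * powerSpectrum (Uᵀ i) ω - g (f ω)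
        = ∑ i, w i * (g (d i) - g (f ω)) := by
      simp_rw [mul_sub]
      rw [Finset.sum_sub_distrib, ← Finset.sum_mul, hw1, one_mul, Finset.mul_sum]
      congr 1
      exact Finset.sum_congr rfl fun i _ => by simp only [w]; ring
    rw [heq]
    calc _ ≤ ∑ i, w i * (L * |d i - f ω|) := by
          refine (norm_sum_le _ _).trans (Finset.sum_le_sum fun i _ => ?_)
          rw [norm_mul, Real.norm_of_nonneg (hw0 i)]
          exact mul_le_mul_of_nonneg_left (hg.norm_sub_le (hd i) (hfK ω)) (hw0 i)
      _ = L * ∑ i, w i * |d i - f ω| := by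
          rw [Finset.mul_sum]
          exact Finset.sum_congr rfl fun i _ => by ring
      _ ≤ _ := mul_le_mul_of_nonneg_left hmean L.2
  have hbd := intervalIntegral.norm_integral_le_of_norm_le_const
    (a := 0) (b := 2 * Real.pi) fun ω _ => hpt ω
  rw [hint, abs_mul, abs_of_nonneg (by positivity), ← Real.norm_eq_abs]
  calc _ ≤ 1 / (2 * Real.pi) * (L * √ε * |2 * Real.pi - 0|) :=
        mul_le_mul_of_nonneg_left hbd (by positivity)
    _ = L * √ε := by
        rw [sub_zero, abs_of_pos (by positivity)]
        field_simp

/-- **Szegő's first limit theorem** for Lipschitz test functions and absolutely summable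
symmetric coefficients. -/
lemma tendsto_average_eigenvalues_toeplitz (hsymm : ∀ k, r (-k) = r k)
    (hsum : Summable fun k => |r k|)
    (hf : ∀ ω φ : ℝ, HasSum (fun k : ℤ => r k * Real.cos (k * ω + φ)) (f ω * Real.cos φ))
    {K : Set ℝ} (hfK : ∀ ω, f ω ∈ K) {g : ℝ → ℝ} {L : NNReal} (hg : LipschitzOnWith L g K)
    {U : (n : ℕ) → Matrix (Fin n) (Fin n) ℝ} {d : (n : ℕ) → Fin n → ℝ}
    (hU : ∀ n, (U n)ᵀ * U n = 1) (hU' : ∀ n, U n * (U n)ᵀ = 1)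
    (hS : ∀ n, (of fun i j : Fin n => r ((i : ℕ) - (j : ℕ) : ℤ))
      = U n * diagonal (d n) * (U n)ᵀ)
    (hd : ∀ n i, d n i ∈ K) :
    Tendsto (fun n : ℕ => (1 / (n : ℝ)) * ∑ i, g (d n i)) atTop
      (𝓝 ((1 / (2 * Real.pi)) * ∫ ω in (0 : ℝ)..(2 * Real.pi), g (f ω))) := by
  rw [tendsto_iff_norm_sub_tendsto_zero]
  have h1 : Tendsto (fun m : ℕ => tailMass r (m + 1) ^ 2) atTop (𝓝 0) := by
    simpa using ((tendsto_tailMass hsum).comp (tendsto_add_atTop_nat 1)).pow 2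
  have h2 := ((h1.cesaro.const_mul 8).sqrt).const_mul (L : ℝ)
  rw [mul_zero, Real.sqrt_zero, mul_zero] at h2
  refine squeeze_zero' (.of_forall fun _ => norm_nonneg _) ?_ h2
  filter_upwards [eventually_gt_atTop 0] with n hn
  exact abs_average_eigenvalues_sub_integral_le hsymm hsum hf hfK hg hn (hU n) (hU' n) (hS n)
    (hd n)

end Toeplitz

lemma hasSum_mul_cos_of_eq_tsum_exp {r : ℤ → ℝ} (hsum : Summable fun k => |r k|) {f : ℝ → ℝ}
    (hf : ∀ ω : ℝ, (f ω : ℂ) = ∑' k : ℤ, (r k : ℂ) * Complex.exp (-Complex.I * k * ω))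
    (ω φ : ℝ) :
    HasSum (fun k : ℤ => r k * Real.cos (k * ω + φ)) (f ω * Real.cos φ) := by
  have hexp (k : ℤ) : Complex.exp (-Complex.I * k * ω)
      = Complex.exp ((-(k * ω) : ℝ) * Complex.I) := by
    congr 1; push_cast; ring
  have h : HasSum (fun k : ℤ => (r k : ℂ) * Complex.exp (-Complex.I * k * ω)) (f ω) := by
    rw [hf]
    refine Summable.hasSum (.of_norm ?_)
    refine hsum.congr fun k => ?_
    rw [hexp, norm_mul, Complex.norm_exp_ofReal_mul_I, Complex.norm_real, mul_one,
      Real.norm_eq_abs]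
  have hre := Complex.hasSum_re h
  have him := Complex.hasSum_im h
  simp only [hexp, Complex.re_ofReal_mul, Complex.im_ofReal_mul, Complex.exp_ofReal_mul_I_re,
    Complex.exp_ofReal_mul_I_im, Complex.ofReal_re, Complex.ofReal_im, Real.cos_neg,
    Real.sin_neg] at hre him
  have h2 := (hre.mul_right (Real.cos φ)).add (him.mul_right (Real.sin φ))
  rw [zero_mul, add_zero] at h2
  refine h2.congr_fun fun k => ?_
  rw [Real.cos_add]
  ring

lemma lipschitzOnWith_log_one_sub {a b c δ : ℝ} (hδ : 0 < δ) {K : Set ℝ}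
    (hK : ∀ x ∈ K, δ ≤ 1 - a * (b + c * x)) :
    LipschitzOnWith (|a * c| / δ).toNNReal (fun x => Real.log (1 - a * (b + c * x))) K := by
  have key : ∀ x ∈ K, ∀ y ∈ K,
      Real.log (1 - a * (b + c * x)) - Real.log (1 - a * (b + c * y))
        ≤ |a * c| / δ * |x - y| := fun x hx y hy => by
    have hx' := hδ.trans_le (hK x hx)
    have hy' := hδ.trans_le (hK y hy)
    rw [← Real.log_div hx'.ne' hy'.ne']
    refine (Real.log_le_sub_one_of_pos (div_pos hx' hy')).trans ?_
    rw [div_sub_one hy'.ne', div_mul_eq_mul_div, ← abs_mul]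
    calc _ ≤ |a * c * (x - y)| / (1 - a * (b + c * y)) := by
          refine div_le_div_of_nonneg_right ?_ hy'.le
          refine le_trans (le_of_eq ?_) (neg_le_abs _)
          ring
      _ ≤ _ := div_le_div_of_nonneg_left (abs_nonneg _) hδ (hK y hy)
  refine LipschitzOnWith.of_dist_le_mul fun x hx y hy => ?_
  rw [Real.coe_toNNReal _ (by positivity), Real.dist_eq, Real.dist_eq]
  refine abs_sub_le_iff.2 ⟨key x hx y hy, ?_⟩
  rw [abs_sub_comm x y]
  exact key y hy x hx

/-- limiting normalized cumulant generating function of the simple quadratic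
detector's statistic under `H₁`.  Let `σ, θ > 0`, let `r : ℤ → ℝ` be a symmetric absolutely
summable unit-variance autocovariance (`r 0 = 1`) with spectral density
`f_s(ω) = ∑_k r(k) e^{-ikω}`, `0 ≤ f_s ≤ M`, and positive semidefinite Toeplitz matrices
`Σ_{s,n} = (r(i-j))`.  Let `yₙ ~ N(0, σ² I + θ² Σ_{s,n})` (realized as the law of `Aₙ ⬝ Z` with
`Aₙ Aₙᵀ = σ² I + θ² Σ_{s,n}`, `Z` standard Gaussian) and
`T_{sq,n}(y) = (1/2) log (σ²/(σ²+θ²)) + (θ²/(2nσ²(σ²+θ²))) ∑ᵢ yᵢ²`.  Then for every real `t` with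
`t θ² (σ² + θ² M)/(σ²(σ²+θ²)) < 1`,
`(1/n) log E[exp (n t T_{sq,n}(yₙ))] →
  (t/2) log (σ²/(σ²+θ²)) - (1/4π) ∫₀^{2π} log (1 - t θ² (σ² + θ² f_s(ω))/(σ²(σ²+θ²))) dω`. -/
theorem simple_quadratic_cgf_H1
    (σ θ : ℝ) (hσ : 0 < σ) (hθ : 0 < θ)
    (r : ℤ → ℝ) (hr0 : r 0 = 1) (hsymm : ∀ k, r (-k) = r k) (hsum : Summable fun k => |r k|)
    (f : ℝ → ℝ)
    (hf : ∀ ω : ℝ, (f ω : ℂ) = ∑' k : ℤ, (r k : ℂ) * Complex.exp (-Complex.I * k * ω))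
    (M : ℝ) (hbound : ∀ ω : ℝ, 0 ≤ f ω ∧ f ω ≤ M)
    (hpsd : ∀ n : ℕ, (Matrix.of fun i j : Fin n => r ((i.val : ℤ) - (j.val : ℤ))).PosSemidef)
    (A : (n : ℕ) → Matrix (Fin n) (Fin n) ℝ)
    (hA : ∀ n : ℕ, A n * (A n)ᵀ
        = σ ^ 2 • (1 : Matrix (Fin n) (Fin n) ℝ)
          + θ ^ 2 • Matrix.of fun i j : Fin n => r ((i.val : ℤ) - (j.val : ℤ)))
    (T : (n : ℕ) → (Fin n → ℝ) → ℝ)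
    (hT : ∀ (n : ℕ) (y : Fin n → ℝ),
        T n y = (1 / 2) * Real.log (σ ^ 2 / (σ ^ 2 + θ ^ 2))
          + (θ ^ 2 / (2 * n * σ ^ 2 * (σ ^ 2 + θ ^ 2))) * ∑ i, (y i) ^ 2)
    (t : ℝ) (ht : t * θ ^ 2 * (σ ^ 2 + θ ^ 2 * M) / (σ ^ 2 * (σ ^ 2 + θ ^ 2)) < 1) :
    Tendsto (fun n : ℕ => (1 / (n : ℝ)) * Real.log (∫ y, Real.exp ((n : ℝ) * t * T n y)
        ∂(Measure.map (A n).mulVec (Measure.pi fun _ : Fin n => gaussianReal 0 1)))) atTop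
      (𝓝 ((t / 2) * Real.log (σ ^ 2 / (σ ^ 2 + θ ^ 2))
        - (1 / (4 * Real.pi)) * ∫ ω in (0 : ℝ)..(2 * Real.pi),
            Real.log (1 - t * θ ^ 2 * (σ ^ 2 + θ ^ 2 * f ω) / (σ ^ 2 * (σ ^ 2 + θ ^ 2))))) := by
  set a : ℝ := t * θ ^ 2 / (σ ^ 2 * (σ ^ 2 + θ ^ 2)) with ha
  have hM1 : a * (σ ^ 2 + θ ^ 2 * M) < 1 := by rwa [ha, div_mul_eq_mul_div]
  obtain ⟨δ, hδ, hK⟩ : ∃ δ > 0, ∀ x ∈ Set.Icc 0 M, δ ≤ 1 - a * (σ ^ 2 + θ ^ 2 * x) := by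
    refine ⟨min 1 (1 - a * (σ ^ 2 + θ ^ 2 * M)), lt_min one_pos (by linarith), fun x hx => ?_⟩
    have hpos : 0 ≤ σ ^ 2 + θ ^ 2 * x := by have := hx.1; positivity
    rcases le_total 0 a with h | h
    · refine (min_le_right _ _).trans ?_
      have := hx.2
      gcongr
    · refine (min_le_left _ _).trans ?_
      linarith [mul_nonpos_of_nonpos_of_nonneg h hpos]
  have hcos := hasSum_mul_cos_of_eq_tsum_exp hsum hf
  choose U d hU hU' hS hd0 using fun n => (hpsd n).exists_orthogonal_diagonalization
  have hd (n) (i : Fin n) : d n i ∈ Set.Icc 0 M :=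
    ⟨hd0 n i, eigenvalue_toeplitz_le hsymm hsum hcos (fun ω => (hbound ω).2) (hU n) (hS n) i⟩
  have hlim := tendsto_average_eigenvalues_toeplitz hsymm hsum hcos hbound
    (lipschitzOnWith_log_one_sub hδ hK) hU hU' hS hd
  have hmain (n : ℕ) (hn : 0 < n) :
      (1 / (n : ℝ)) * Real.log (∫ y, Real.exp ((n : ℝ) * t * T n y)
        ∂(Measure.map (A n).mulVec (Measure.pi fun _ : Fin n => gaussianReal 0 1)))
      = (t / 2) * Real.log (σ ^ 2 / (σ ^ 2 + θ ^ 2))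
        - (1 / 2) * ((1 / (n : ℝ)) * ∑ i, Real.log (1 - a * (σ ^ 2 + θ ^ 2 * d n i))) := by
    have hn' : (n : ℝ) ≠ 0 := by positivity
    have hdiag : A n * (A n)ᵀ = U n * diagonal (fun i => σ ^ 2 + θ ^ 2 * d n i) * (U n)ᵀ := by
      have h : (diagonal fun i => σ ^ 2 + θ ^ 2 * d n i)
          = σ ^ 2 • (1 : Matrix (Fin n) (Fin n) ℝ) + θ ^ 2 • diagonal (d n) := by
        rw [smul_one_eq_diagonal, ← diagonal_smul, diagonal_add]
        rfl
      rw [hA, h, hS]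
      simp [Matrix.mul_add, Matrix.add_mul, hU']
    have hpos (i : Fin n) : 0 < 1 - a * (σ ^ 2 + θ ^ 2 * d n i) := hδ.trans_le (hK _ (hd n i))
    have hexp (y : Fin n → ℝ) : Real.exp ((n : ℝ) * t * T n y)
        = Real.exp (n * (t / 2 * Real.log (σ ^ 2 / (σ ^ 2 + θ ^ 2))))
          * Real.exp (a / 2 * ∑ i, y i ^ 2) := by
      rw [← Real.exp_add, hT, ha]
      congr 1
      field_simp
    simp_rw [hexp]
    rw [integral_const_mul, integral_exp_sum_sq_map_mulVec (hU n) (hU' n) hdiag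
      (fun i => by have := hd0 n i; positivity) (fun i => by linarith [hpos i]),
      Real.log_mul (Real.exp_ne_zero _) (Finset.prod_ne_zero_iff.2 fun i _ =>
        one_div_ne_zero (Real.sqrt_pos.2 (hpos i)).ne'), Real.log_exp,
      Real.log_prod fun i _ => one_div_ne_zero (Real.sqrt_pos.2 (hpos i)).ne']
    simp_rw [one_div (√_), Real.log_inv, Real.log_sqrt (hpos _).le, Finset.sum_neg_distrib,
      ← Finset.sum_div]
    field_simp
    ring
  have hfinal := (hlim.const_mul (1 / 2)).const_sub
    ((t / 2) * Real.log (σ ^ 2 / (σ ^ 2 + θ ^ 2)))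
  have hint (ω : ℝ) : Real.log (1 - t * θ ^ 2 * (σ ^ 2 + θ ^ 2 * f ω) / (σ ^ 2 * (σ ^ 2 + θ ^ 2)))
      = Real.log (1 - a * (σ ^ 2 + θ ^ 2 * f ω)) := by
    rw [ha, div_mul_eq_mul_div]
  simp_rw [hint]
  have hconst : (1 / (4 * Real.pi)) * (∫ ω in (0 : ℝ)..(2 * Real.pi),
        Real.log (1 - a * (σ ^ 2 + θ ^ 2 * f ω)))
      = 1 / 2 * ((1 / (2 * Real.pi)) * ∫ ω in (0 : ℝ)..(2 * Real.pi),
        Real.log (1 - a * (σ ^ 2 + θ ^ 2 * f ω))) := by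
    ring
  rw [hconst]
  refine hfinal.congr' ?_
  filter_upwards [eventually_gt_atTop 0] with n hn
  exact (hmain n hn).symm
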